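/- Suppose the complementary function ψ satisfies the Δ₂ condition for all values, ∫₀^∞ ω(t) dt = ∞ and ω is positive on [0,∞). Fix x in the unit sphere of Λ°_{φ,ω}[0,∞). Then there exists δ = δ(x) ∈ (0,1) such that for every y in the closed unit ball of Λ°_{φ,ω}[0,∞), min{‖(x−y)/2‖°_{φ,ω}, ‖(x+y)/2‖°_{φ,ω}} ≤ 1 − δ. -/

import Mathlib

open MeasureTheory Set Filter Topology
open scoped ENNReal

noncomputable section

/-- An Orlicz function: convex, even, vanishing only at `0`, with
`φ(u)/u → 0` as `u → 0⁺` and `φ(u)/u → ∞` as `u → ∞`. -/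
def IsOrliczFunction (φ : ℝ → ℝ) : Prop :=
  ConvexOn ℝ Set.univ φ ∧ (∀ u, φ (-u) = φ u) ∧ φ 0 = 0 ∧
    (∀ u : ℝ, 0 < u → 0 < φ u) ∧ (∀ u : ℝ, 0 ≤ φ u) ∧
    Filter.Tendsto (fun u => φ u / u) (nhdsWithin 0 (Set.Ioi 0)) (nhds 0) ∧
    Filter.Tendsto (fun u => φ u / u) Filter.atTop Filter.atTop

/-- The complementary (conjugate) Orlicz function `ψ(v) = sup_{u>0} (|uv| - φ(u))`. -/
def complementaryFn (φ : ℝ → ℝ) (v : ℝ) : ℝ :=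
  sSup {w | ∃ u : ℝ, 0 < u ∧ w = |u * v| - φ u}

/-- The `Δ₂` condition for all values. -/
def Delta2All (φ : ℝ → ℝ) : Prop :=
  ∃ K : ℝ, 0 < K ∧ ∀ u : ℝ, φ (2 * u) ≤ K * φ u

/-- The `Δ₂` condition for large values. -/
def Delta2Large (φ : ℝ → ℝ) : Prop :=
  ∃ K : ℝ, 0 < K ∧ ∃ u₀ : ℝ, 0 ≤ u₀ ∧ ∀ u : ℝ, u₀ ≤ u → φ (2 * u) ≤ K * φ u

/-- The interval `[0, γ)` viewed inside `ℝ`, where `γ ≤ ∞`. -/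
def domSet (γ : ℝ≥0∞) : Set ℝ := {s : ℝ | 0 ≤ s ∧ (ENNReal.ofReal s) < γ}

/-- The decreasing rearrangement of `x` (with underlying domain `D`):
`x*(t) = inf {θ > 0 : μ{s ∈ D : |x(s)| > θ} ≤ t}`. -/
def rearr (D : Set ℝ) (x : ℝ → ℝ) (t : ℝ) : ℝ :=
  sInf {θ : ℝ | 0 < θ ∧ volume {s ∈ D | θ < |x s|} ≤ ENNReal.ofReal t}

/-- A weight function on `D`: non-increasing, non-negative and locally integrable. -/
def IsWeight (D : Set ℝ) (ω : ℝ → ℝ) : Prop :=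
  (∀ t ∈ D, 0 ≤ ω t) ∧ AntitoneOn ω D ∧
    ∀ t : ℝ, IntegrableOn ω (D ∩ Set.Icc 0 t) volume

/-- The modular `ρ_{φ,ω}(x) = ∫_D φ(x*(t)) ω(t) dt`. -/
def olModular (D : Set ℝ) (φ ω x : ℝ → ℝ) : ℝ≥0∞ :=
  ∫⁻ t in D, ENNReal.ofReal (φ (rearr D x t) * ω t)

/-- Membership in the Orlicz–Lorentz space `Λ_{φ,ω}`. -/
def MemOL (D : Set ℝ) (φ ω x : ℝ → ℝ) : Prop :=
  Measurable x ∧ ∃ l : ℝ, 0 < l ∧ olModular D φ ω (fun t => l * x t) < ⊤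

/-- The Orlicz (Amemiya) norm `‖x‖° = inf_{k>0} (1 + ρ_{φ,ω}(kx))/k`. -/
def orliczNorm (D : Set ℝ) (φ ω x : ℝ → ℝ) : ℝ≥0∞ :=
  ⨅ k ∈ Set.Ioi (0:ℝ), (1 + olModular D φ ω (fun t => k * x t)) / ENNReal.ofReal k

/-- The Luxemburg norm `‖x‖ = inf {ε > 0 : ρ_{φ,ω}(x/ε) ≤ 1}`. -/
def luxNorm (D : Set ℝ) (φ ω x : ℝ → ℝ) : ℝ :=
  sInf {ε : ℝ | 0 < ε ∧ olModular D φ ω (fun t => x t / ε) ≤ 1}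

/-- `K(x) = {k > 0 : ‖x‖° = (1 + ρ_{φ,ω}(kx))/k}`. -/
def KSet (D : Set ℝ) (φ ω x : ℝ → ℝ) : Set ℝ :=
  {k : ℝ | 0 < k ∧
    orliczNorm D φ ω x = (1 + olModular D φ ω (fun t => k * x t)) / ENNReal.ofReal k}

/-- The Lorentz norm `‖x‖_{1,ω} = ∫_D x*(t) ω(t) dt`. -/
def lorentzNorm (D : Set ℝ) (ω x : ℝ → ℝ) : ℝ≥0∞ :=
  ∫⁻ t in D, ENNReal.ofReal (rearr D x t * ω t)

/-- The (generalized right-continuous) inverse of an Orlicz function. -/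
def orliczInv (ψ : ℝ → ℝ) (v : ℝ) : ℝ :=
  sSup {u : ℝ | 0 ≤ u ∧ ψ u ≤ v}

/-- The right derivative of `φ`, as the infimum of right slopes. -/
def rightDerivOf (φ : ℝ → ℝ) (u : ℝ) : ℝ :=
  sInf {r : ℝ | ∃ v : ℝ, u < v ∧ r = (φ v - φ u) / (v - u)}

section OrliczFunction

variable {φ : ℝ → ℝ}

lemma IsOrliczFunction.map_abs (hφ : IsOrliczFunction φ) (u : ℝ) : φ |u| = φ u := by
  rcases abs_choice u with h | h <;> rw [h]
  exact hφ.2.1 u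

lemma IsOrliczFunction.continuous (hφ : IsOrliczFunction φ) : Continuous φ :=
  continuousOn_univ.mp (hφ.1.continuousOn isOpen_univ)

lemma IsOrliczFunction.map_mul_le (hφ : IsOrliczFunction φ) {a u : ℝ} (ha : 0 ≤ a) (ha1 : a ≤ 1) :
    φ (a * u) ≤ a * φ u := by
  have := hφ.1.2 (mem_univ u) (mem_univ 0) ha (sub_nonneg.2 ha1) (by ring)
  simpa [hφ.2.2.1] using this

lemma IsOrliczFunction.strictMonoOn (hφ : IsOrliczFunction φ) : StrictMonoOn φ (Ici 0) := by
  intro u hu v _ huv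
  have hv : 0 < v := lt_of_le_of_lt hu huv
  have h := hφ.map_mul_le (a := u / v) (u := v) (by have := hv.le; have : 0 ≤ u := hu; positivity)
    ((div_le_one hv).2 huv.le)
  rw [div_mul_cancel₀ _ hv.ne'] at h
  have h1 : u / v < 1 := (div_lt_one hv).2 huv
  have h2 := hφ.2.2.2.1 v hv
  nlinarith

lemma IsOrliczFunction.map_le_map (hφ : IsOrliczFunction φ) {u v : ℝ} (h : |u| ≤ |v|) :
    φ u ≤ φ v := by
  rw [← hφ.map_abs u, ← hφ.map_abs v]
  exact hφ.strictMonoOn.monotoneOn (abs_nonneg u) (abs_nonneg v) h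

lemma IsOrliczFunction.exists_preimage (hφ : IsOrliczFunction φ) {θ : ℝ} (hθ : 0 < θ) :
    ∃ τ, 0 < τ ∧ φ τ = θ := by
  have h := hφ.2.2.2.2.2.2
  obtain ⟨b, hb1, hb⟩ := ((h.eventually_ge_atTop θ).and (eventually_ge_atTop 1)).exists
  have hb' : θ ≤ φ b := by
    have : θ * b ≤ φ b := (le_div_iff₀ (by linarith)).1 hb1
    nlinarith
  obtain ⟨τ, hτ, hτ'⟩ := intermediate_value_Icc (by linarith : (0 : ℝ) ≤ b)
    hφ.continuous.continuousOn (show θ ∈ Icc (φ 0) (φ b) from ⟨by rw [hφ.2.2.1]; exact hθ.le, hb'⟩)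
  refine ⟨τ, lt_of_le_of_ne hτ.1 ?_, hτ'⟩
  rintro rfl
  rw [hφ.2.2.1] at hτ'
  exact hθ.ne hτ'

lemma IsOrliczFunction.lt_map_iff (hφ : IsOrliczFunction φ) {τ u : ℝ} (hτ : 0 < τ) :
    φ τ < φ u ↔ τ < |u| := by
  rw [← hφ.map_abs u]
  exact hφ.strictMonoOn.lt_iff_lt hτ.le (abs_nonneg u)

lemma IsOrliczFunction.bddAbove_complementary (hφ : IsOrliczFunction φ) (v : ℝ) :
    BddAbove {w | ∃ u : ℝ, 0 < u ∧ w = |u * v| - φ u} := by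
  obtain ⟨b, hb⟩ := (hφ.2.2.2.2.2.2.eventually_ge_atTop |v|).exists_forall_of_atTop
  refine ⟨|b| * |v|, ?_⟩
  rintro _ ⟨u, hu, rfl⟩
  rw [abs_mul, abs_of_pos hu]
  have h0 := hφ.2.2.2.2.1 u
  rcases le_total b u with h | h
  · have := (le_div_iff₀ hu).1 (hb u h)
    have : 0 ≤ |b| * |v| := by positivity
    linarith
  · have : u * |v| ≤ |b| * |v| :=
      mul_le_mul_of_nonneg_right (h.trans (le_abs_self b)) (abs_nonneg v)
    linarith

lemma IsOrliczFunction.exists_subgradient (hφ : IsOrliczFunction φ) (w : ℝ) :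
    ∃ v, ∀ z, φ w + v * (z - w) ≤ φ z := by
  have hw : w ∈ interior (univ : Set ℝ) := by simp
  refine ⟨derivWithin φ (Ioi w) w, fun z => ?_⟩
  rcases lt_trichotomy z w with h | h | h
  · have h1 := hφ.1.slope_le_leftDeriv_of_mem_interior (mem_univ z) hw h
    have h2 := hφ.1.leftDeriv_le_rightDeriv_of_mem_interior hw
    have h3 := h1.trans h2
    rw [slope_def_field, div_le_iff₀ (by linarith)] at h3
    linarith
  · simp [h]
  · have h1 := hφ.1.rightDeriv_le_slope_of_mem_interior hw (mem_univ z) h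
    rw [slope_def_field, le_div_iff₀ (by linarith)] at h1
    linarith

lemma IsOrliczFunction.nabla2 (hφ : IsOrliczFunction φ) (hψ : Delta2All (complementaryFn φ)) :
    ∃ l : ℝ, 2 ≤ l ∧ ∀ w, 0 ≤ w → 2 * l * φ w ≤ φ (l * w) := by
  obtain ⟨K, hK, h⟩ := hψ
  refine ⟨max K 4 / 2, by linarith [le_max_right K 4], fun w hw => ?_⟩
  rcases hw.eq_or_lt with rfl | hw
  · simp [hφ.2.2.1]
  obtain ⟨v, hv⟩ := hφ.exists_subgradient w
  have hv0 : φ w ≤ w * v := by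
    have := hv 0
    rw [hφ.2.2.1] at this
    linarith
  have hvpos : 0 < v := by
    have := hφ.2.2.2.1 w hw
    by_contra! hc
    nlinarith
  have hψv : complementaryFn φ v ≤ w * v - φ w := by
    refine csSup_le ⟨_, 1, one_pos, rfl⟩ ?_
    rintro _ ⟨u, hu, rfl⟩
    rw [abs_of_pos (by positivity)]
    linarith [hv u]
  have hz : 0 < max K 4 / 2 * w := by have := le_max_right K 4; positivity
  have h2 : 2 * v * (max K 4 / 2 * w) - φ (max K 4 / 2 * w) ≤ complementaryFn φ (2 * v) := by
    refine le_csSup (hφ.bddAbove_complementary _) ⟨_, hz, ?_⟩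
    rw [abs_of_pos (by positivity)]
    ring
  have h3 : K * complementaryFn φ v ≤ max K 4 * (w * v - φ w) :=
    (mul_le_mul_of_nonneg_left hψv hK.le).trans
      (mul_le_mul_of_nonneg_right (le_max_left K 4) (by linarith))
  have := h v
  linarith

lemma IsOrliczFunction.exists_contraction (hφ : IsOrliczFunction φ)
    (hψ : Delta2All (complementaryFn φ)) {a₀ : ℝ} (ha₀ : 0 < a₀) (ha₀' : a₀ ≤ 1 / 2) :
    ∃ η ∈ Ioo (0 : ℝ) 1, ∀ α u, 0 ≤ α → α ≤ 1 - a₀ → φ (α * u) ≤ η * (α * φ u) := by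
  obtain ⟨l, hl, h⟩ := hφ.nabla2 hψ
  have hl0 : 0 < l := by linarith
  have key : ∀ u, φ ((1 - a₀) * u) ≤ (1 - a₀ / (2 * l)) * ((1 - a₀) * φ u) := by
    intro u
    rw [← hφ.map_abs u, ← hφ.map_abs, abs_mul, abs_of_pos (by linarith : 0 < 1 - a₀)]
    generalize |u| = v, abs_nonneg u = hv
    have h1 := h (v / l) (by positivity)
    rw [mul_div_cancel₀ _ hl0.ne'] at h1
    set s := a₀ / (1 - 1 / l) with hs
    have hli : 1 / l ≤ 1 / 2 := by
      apply one_div_le_one_div_of_le <;> linarith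
    have hlpos : 0 < 1 / l := by positivity
    have hsl : a₀ ≤ s := by
      rw [hs, le_div_iff₀ (by linarith)]
      nlinarith
    have hs1 : s ≤ 1 := by
      rw [hs, div_le_one (by linarith)]
      linarith
    have hse : s * (1 - 1 / l) = a₀ := div_mul_cancel₀ _ (by linarith)
    have h2 := hφ.1.2 (mem_univ (v / l)) (mem_univ v) (by linarith : 0 ≤ s)
      (sub_nonneg.2 hs1) (by ring)
    have he : s • (v / l) + (1 - s) • v = (1 - a₀) * v := by
      rw [← hse]; simp only [smul_eq_mul]; ring
    rw [he] at h2
    simp only [smul_eq_mul] at h2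
    have hφv := hφ.2.2.2.2.1 v
    have h3 : φ (v / l) ≤ (1 / l) / 2 * φ v := by
      rw [div_div, one_div_mul_eq_div, le_div_iff₀ (by positivity)]
      linarith
    have h4 : φ ((1 - a₀) * v) ≤ (1 - a₀ - s * (1 / l) / 2) * φ v := by
      have := mul_le_mul_of_nonneg_left h3 (by linarith : 0 ≤ s)
      have e : (1 - a₀ - s * (1 / l) / 2) * φ v = s * ((1 / l) / 2 * φ v) + (1 - s) * φ v := by
        linear_combination φ v * hse
      linarith
    refine h4.trans ?_
    rw [← mul_assoc]
    refine mul_le_mul_of_nonneg_right ?_ hφv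
    have e : a₀ / (2 * l) = a₀ * (1 / l) / 2 := by field_simp
    rw [e]
    have : a₀ * (1 / l) ≤ s * (1 / l) := mul_le_mul_of_nonneg_right hsl hlpos.le
    have : 0 ≤ a₀ * (a₀ * (1 / l)) := by positivity
    nlinarith
  have hq : a₀ / (2 * l) < 1 := by
    rw [div_lt_one (by positivity)]
    linarith
  refine ⟨1 - a₀ / (2 * l), ⟨by linarith, by have : 0 < a₀ / (2 * l) := by positivity
                                             linarith⟩, fun α u h0 h1 => ?_⟩
  have hb : 0 < 1 - a₀ := by linarith
  have := hφ.map_mul_le (a := α / (1 - a₀)) (u := (1 - a₀) * u) (by positivity)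
    ((div_le_one hb).2 h1)
  rw [← mul_assoc, div_mul_cancel₀ _ hb.ne'] at this
  refine this.trans ((mul_le_mul_of_nonneg_left (key u) (by positivity)).trans_eq ?_)
  field_simp

end OrliczFunction

section WeightedChoquet

/-- The distribution function of `h` on the half-line. -/
def halfDist (h : ℝ → ℝ) (θ : ℝ) : ℝ≥0∞ := volume.restrict (Ici 0) {s | θ < h s}

/-- The primitive of the weight `ω`, extended to `[0, ∞]`. -/
def weightPrimitive (ω : ℝ → ℝ) (s : ℝ≥0∞) : ℝ≥0∞ :=
  ∫⁻ t in {t : ℝ | 0 ≤ t ∧ ENNReal.ofReal t < s}, ENNReal.ofReal (ω t)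

/-- The Lorentz functional `∫ h* ω`, written through the distribution function of `h`. -/
def weightedChoquet (ω h : ℝ → ℝ) : ℝ≥0∞ :=
  ∫⁻ θ in Ioi 0, weightPrimitive ω (halfDist h θ)

/-- The integral of the decreasing rearrangement of `h` over an initial interval of length `r`. -/
def truncatedChoquet (r : ℝ≥0∞) (h : ℝ → ℝ) : ℝ≥0∞ :=
  ∫⁻ θ in Ioi 0, min (halfDist h θ) r

lemma halfDist_antitone (h : ℝ → ℝ) : Antitone (halfDist h) :=
  fun _ _ hab => measure_mono fun _ hs => lt_of_le_of_lt hab hs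

lemma halfDist_mono {h g : ℝ → ℝ} (hg : ∀ s, h s ≤ g s) (θ : ℝ) : halfDist h θ ≤ halfDist g θ :=
  measure_mono fun s hs => lt_of_lt_of_le hs (hg s)

lemma weightPrimitive_mono (ω : ℝ → ℝ) : Monotone (weightPrimitive ω) :=
  fun _ _ hab => lintegral_mono_set fun _ ht => ⟨ht.1, ht.2.trans_le hab⟩

lemma volume_ofReal_lt (s : ℝ≥0∞) : volume {t : ℝ | 0 ≤ t ∧ ENNReal.ofReal t < s} = s := by
  induction s with
  | top =>
    have : {t : ℝ | 0 ≤ t ∧ ENNReal.ofReal t < ⊤} = Ici 0 := by ext; simp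
    rw [this, Real.volume_Ici]
  | coe s =>
    have : {t : ℝ | 0 ≤ t ∧ ENNReal.ofReal t < s} = Ico 0 (s : ℝ) := by
      ext t
      simp only [mem_ofPred_eq, mem_Ico, and_congr_right_iff]
      intro ht
      rw [← ENNReal.ofReal_coe_nnreal, ENNReal.ofReal_lt_ofReal_iff_of_nonneg ht]
    rw [this, Real.volume_Ico]
    simp

lemma measure_inter_eq_min {α : Type*} [MeasurableSpace α] (μ : Measure α) {A B : Set α}
    (h : A ⊆ B ∨ B ⊆ A) : μ (A ∩ B) = min (μ A) (μ B) := by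
  rcases h with h | h
  · rw [inter_eq_left.2 h, min_eq_left (measure_mono h)]
  · rw [inter_eq_right.2 h, min_eq_right (measure_mono h)]

lemma weightPrimitive_eq {ω : ℝ → ℝ} (hω : Antitone ω) (hω0 : ∀ t, 0 ≤ ω t) (s : ℝ≥0∞) :
    weightPrimitive ω s = ∫⁻ l in Ioi 0, min s (halfDist ω l) := by
  rw [weightPrimitive, lintegral_eq_lintegral_meas_lt _ (Eventually.of_forall hω0)
    hω.measurable.aemeasurable]
  refine lintegral_congr fun l => ?_
  have hm : MeasurableSet {a | l < ω a} := measurableSet_lt measurable_const hω.measurable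
  rw [halfDist, Measure.restrict_apply hm, Measure.restrict_apply hm, ← volume_ofReal_lt s,
    volume_ofReal_lt s]
  have e : {a | l < ω a} ∩ {t | 0 ≤ t ∧ ENNReal.ofReal t < s} =
      {t | 0 ≤ t ∧ ENNReal.ofReal t < s} ∩ ({a | l < ω a} ∩ Ici 0) := by
    ext t; simp only [mem_inter_iff, mem_ofPred_eq, mem_Ici]; tauto
  rw [e, measure_inter_eq_min, volume_ofReal_lt]
  by_contra! hc
  obtain ⟨⟨a, ha, ha'⟩, b, hb, hb'⟩ := And.imp not_subset.1 not_subset.1 hc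
  rcases le_total a b with hab | hab
  · exact ha' ⟨lt_of_lt_of_le hb.1 (hω hab), ha.1⟩
  · exact hb' ⟨hb.2, (ENNReal.ofReal_le_ofReal hab).trans_lt ha.2⟩

lemma weightedChoquet_eq {ω : ℝ → ℝ} (hω : Antitone ω) (hω0 : ∀ t, 0 ≤ ω t) (h : ℝ → ℝ) :
    weightedChoquet ω h = ∫⁻ l in Ioi 0, truncatedChoquet (halfDist ω l) h := by
  simp only [weightedChoquet, weightPrimitive_eq hω hω0, truncatedChoquet]
  refine lintegral_lintegral_swap (Measurable.aemeasurable ?_)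
  exact ((halfDist_antitone h).measurable.comp measurable_fst).min
    ((halfDist_antitone ω).measurable.comp measurable_snd)

lemma truncatedChoquet_mono (h : ℝ → ℝ) : Monotone fun r => truncatedChoquet r h :=
  fun _ _ hab => lintegral_mono fun _ => min_le_min le_rfl hab

lemma lintegral_ofReal_sub {h : ℝ → ℝ} (hm : Measurable h) (c : ℝ) :
    ∫⁻ s in Ici (0 : ℝ), ENNReal.ofReal (h s - c) = ∫⁻ θ in Ioi c, halfDist h θ := by
  have e : ∀ s, ENNReal.ofReal (h s - c) = ENNReal.ofReal (max (h s - c) 0) := by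
    intro s
    rcases le_total (h s - c) 0 with h | h
    · rw [max_eq_right h, ENNReal.ofReal_of_nonpos h, ENNReal.ofReal_zero]
    · rw [max_eq_left h]
  simp only [e]
  rw [lintegral_eq_lintegral_meas_lt _ (f := fun s => max (h s - c) 0)
    (Eventually.of_forall fun s => le_max_right _ _)
    ((hm.sub_const c).max measurable_const).aemeasurable]
  have e2 : ∀ θ ∈ Ioi (0 : ℝ), volume.restrict (Ici (0 : ℝ)) {a | θ < max (h a - c) 0} =
      halfDist h (θ + c) := by
    intro θ hθ
    rw [halfDist]
    congr 1
    ext a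
    simp only [mem_ofPred_eq, lt_max_iff, not_lt.2 (le_of_lt (mem_Ioi.1 hθ)), or_false]
    exact lt_sub_iff_add_lt
  rw [setLIntegral_congr_fun measurableSet_Ioi e2, ← lintegral_indicator measurableSet_Ioi,
    ← lintegral_indicator measurableSet_Ioi,
    ← lintegral_add_right_eq_self (fun θ => (Ioi c).indicator (halfDist h) θ) c]
  refine lintegral_congr fun θ => ?_
  simp [indicator_apply]

lemma truncatedChoquet_le {h : ℝ → ℝ} (hm : Measurable h) (r : ℝ≥0∞) {c : ℝ} (hc : 0 ≤ c) :
    truncatedChoquet r h ≤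
      r * ENNReal.ofReal c + ∫⁻ s in Ici (0 : ℝ), ENNReal.ofReal (h s - c) := by
  rw [lintegral_ofReal_sub hm, truncatedChoquet, ← Ioc_union_Ioi_eq_Ioi hc]
  refine (lintegral_union_le _ _ _).trans (add_le_add ?_ ?_)
  · refine (lintegral_mono fun θ => min_le_right _ _).trans ?_
    simp
  · exact lintegral_mono fun θ => min_le_left _ _

lemma exists_le_truncatedChoquet {h : ℝ → ℝ} (hm : Measurable h) {r : ℝ≥0∞} (hr : r ≠ 0)
    (hfin : truncatedChoquet r h ≠ ⊤) :
    ∃ c, 0 ≤ c ∧ r * ENNReal.ofReal c + ∫⁻ s in Ici (0 : ℝ), ENNReal.ofReal (h s - c) ≤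
      truncatedChoquet r h := by
  set S := {θ | 0 ≤ θ ∧ halfDist h θ ≤ r} with hS
  have hbdd : BddBelow S := ⟨0, fun θ hθ => hθ.1⟩
  have hne : S.Nonempty := by
    by_contra hc
    refine hfin ?_
    have : ∀ θ ∈ Ioi (0 : ℝ), min (halfDist h θ) r = r := by
      intro θ hθ
      refine min_eq_right (le_of_not_ge fun hle => hc ⟨θ, le_of_lt hθ, hle⟩)
    rw [truncatedChoquet, setLIntegral_congr_fun measurableSet_Ioi this]
    simp [hr]
  refine ⟨sInf S, Real.sInf_nonneg fun θ hθ => hθ.1, ?_⟩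
  have hc0 : 0 ≤ sInf S := Real.sInf_nonneg fun θ hθ => hθ.1
  have h1 : ∀ θ ∈ Ioo 0 (sInf S), r = min (halfDist h θ) r := by
    intro θ hθ
    refine (min_eq_right (le_of_not_ge fun hle => ?_)).symm
    exact hθ.2.not_ge (csInf_le hbdd ⟨hθ.1.le, hle⟩)
  have h2 : ∀ θ ∈ Ioi (sInf S), halfDist h θ = min (halfDist h θ) r := by
    intro θ hθ
    obtain ⟨a, ha, hlt⟩ := exists_lt_of_csInf_lt hne hθ
    exact (min_eq_left ((halfDist_antitone h hlt.le).trans ha.2)).symm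
  rw [lintegral_ofReal_sub hm, setLIntegral_congr_fun measurableSet_Ioi h2]
  have h3 : r * ENNReal.ofReal (sInf S) = ∫⁻ θ in Ioo 0 (sInf S), min (halfDist h θ) r := by
    rw [← setLIntegral_congr_fun measurableSet_Ioo h1]
    simp
  rw [h3, ← lintegral_union measurableSet_Ioi
    (disjoint_left.2 fun θ h h' => lt_asymm h.2 h')]
  exact lintegral_mono_set (union_subset Ioo_subset_Ioi_self (Ioi_subset_Ioi hc0))

lemma truncatedChoquet_add_le {u v : ℝ → ℝ} (hu : Measurable u) (hv : Measurable v) (r : ℝ≥0∞) :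
    truncatedChoquet r (fun s => u s + v s) ≤ truncatedChoquet r u + truncatedChoquet r v := by
  rcases eq_or_ne r 0 with rfl | hr
  · simp [truncatedChoquet]
  by_cases hfu : truncatedChoquet r u = ⊤
  · simp [hfu]
  by_cases hfv : truncatedChoquet r v = ⊤
  · simp [hfv]
  obtain ⟨a, ha, hau⟩ := exists_le_truncatedChoquet hu hr hfu
  obtain ⟨b, hb, hbv⟩ := exists_le_truncatedChoquet hv hr hfv
  refine (truncatedChoquet_le (hu.add hv) r (add_nonneg ha hb)).trans
    (le_trans ?_ (add_le_add hau hbv))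
  rw [ENNReal.ofReal_add ha hb, mul_add, add_add_add_comm]
  gcongr
  rw [← lintegral_add_left (by fun_prop)]
  refine lintegral_mono fun s => ?_
  rw [Pi.add_apply, add_sub_add_comm]
  exact ENNReal.ofReal_add_le

lemma weightedChoquet_add_le {ω : ℝ → ℝ} (hω : Antitone ω) (hω0 : ∀ t, 0 ≤ ω t) {u v : ℝ → ℝ}
    (hu : Measurable u) (hv : Measurable v) :
    weightedChoquet ω (fun s => u s + v s) ≤ weightedChoquet ω u + weightedChoquet ω v := by
  simp only [weightedChoquet_eq hω hω0]
  rw [← lintegral_add_left]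
  · exact lintegral_mono fun l => truncatedChoquet_add_le hu hv _
  · exact ((truncatedChoquet_mono u).comp_antitone (halfDist_antitone ω)).measurable

lemma weightedChoquet_mono (ω : ℝ → ℝ) {u v : ℝ → ℝ} (h : ∀ s, u s ≤ v s) :
    weightedChoquet ω u ≤ weightedChoquet ω v :=
  lintegral_mono fun θ => weightPrimitive_mono ω (halfDist_mono h θ)

lemma weightedChoquet_const_mul (ω h : ℝ → ℝ) {a : ℝ} (ha : 0 < a) :
    weightedChoquet ω (fun s => a * h s) = ENNReal.ofReal a * weightedChoquet ω h := by
  set f : ℝ → ℝ≥0∞ := fun θ => (Ioi 0).indicator (fun θ => weightPrimitive ω (halfDist h θ)) θ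
    with hf
  have hfm : Measurable f :=
    ((weightPrimitive_mono ω).comp_antitone (halfDist_antitone h)).measurable.indicator
      measurableSet_Ioi
  have e1 : weightedChoquet ω h = ∫⁻ θ, f θ := (lintegral_indicator measurableSet_Ioi _).symm
  have e2 : weightedChoquet ω (fun s => a * h s) = ∫⁻ θ, f (a⁻¹ * θ) := by
    rw [weightedChoquet, ← lintegral_indicator measurableSet_Ioi]
    refine lintegral_congr fun θ => ?_
    have : halfDist (fun s => a * h s) θ = halfDist h (a⁻¹ * θ) := by
      simp only [halfDist, inv_mul_lt_iff₀ ha]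
    by_cases hθ : 0 < θ
    · have : 0 < a⁻¹ * θ := by positivity
      simp [indicator_apply, *]
    · have : ¬ 0 < a⁻¹ * θ := fun hc => hθ (pos_of_mul_pos_right hc (by positivity))
      simp [hf, indicator_apply, hθ, this]
  rw [e1, e2, ← lintegral_map hfm (measurable_const_mul a⁻¹),
    Real.map_volume_mul_left (inv_ne_zero ha.ne'), lintegral_smul_measure, inv_inv, abs_of_pos ha,
    smul_eq_mul]

lemma weightPrimitive_add_le {ω : ℝ → ℝ} (hω : Antitone ω) {n d : ℝ≥0∞} {m D : ℝ} (hm : 0 ≤ m)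
    (hnd : n + ENNReal.ofReal m ≤ d) (hD : d < ENNReal.ofReal D) :
    weightPrimitive ω n + ENNReal.ofReal (m * ω D) ≤ weightPrimitive ω d := by
  have hn : n ≠ ⊤ := ne_top_of_le_ne_top (hD.ne_top) (le_self_add.trans hnd)
  lift n to NNReal using hn
  have hsub : {t : ℝ | 0 ≤ t ∧ ENNReal.ofReal t < n} ∪ Ico (n : ℝ) (n + m) ⊆
      {t : ℝ | 0 ≤ t ∧ ENNReal.ofReal t < d} := by
    rintro t (ht | ht)
    · exact ⟨ht.1, ht.2.trans_le (le_self_add.trans hnd)⟩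
    · refine ⟨n.2.trans ht.1, lt_of_lt_of_le ?_ hnd⟩
      rw [← ENNReal.ofReal_coe_nnreal, ← ENNReal.ofReal_add n.coe_nonneg hm]
      exact (ENNReal.ofReal_lt_ofReal_iff_of_nonneg (n.2.trans ht.1)).2 ht.2
  have hdisj : Disjoint {t : ℝ | 0 ≤ t ∧ ENNReal.ofReal t < n} (Ico (n : ℝ) (n + m)) := by
    refine disjoint_left.2 fun t ht ht' => ?_
    have h2 := ht.2
    rw [← ENNReal.ofReal_coe_nnreal, ENNReal.ofReal_lt_ofReal_iff_of_nonneg ht.1] at h2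
    exact h2.not_ge ht'.1
  refine le_trans ?_ (lintegral_mono_set hsub)
  rw [lintegral_union measurableSet_Ico hdisj]
  refine add_le_add le_rfl ?_
  have : ∫⁻ _ in Ico (n : ℝ) (n + m), ENNReal.ofReal (ω D) = ENNReal.ofReal (m * ω D) := by
    rw [setLIntegral_const, Real.volume_Ico, mul_comm, add_sub_cancel_left, ENNReal.ofReal_mul hm]
  rw [← this]
  refine setLIntegral_mono' measurableSet_Ico fun t ht => ENNReal.ofReal_le_ofReal (hω ?_)
  have h0 : 0 ≤ t := n.2.trans ht.1
  exact (((ENNReal.ofReal_lt_ofReal_iff_of_nonneg h0).1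
    ((hsub (Or.inr ht)).2.trans hD))).le

/-- Deleting a set of measure at least `m` on which `h` is at least `c` decreases the Lorentz
functional by an amount that depends only on `c`, `m`, `ω` and a bound for the functional. -/
lemma weightedChoquet_indicator_add_le {ω : ℝ → ℝ} (hω : Antitone ω) {h : ℝ → ℝ}
    (hh : Measurable h) {S : Set ℝ} (hS : MeasurableSet S) {c m D M : ℝ} (hc : 0 < c) (hm : 0 ≤ m)
    (hmS : ENNReal.ofReal m ≤ volume.restrict (Ici 0) (S ∩ {s | c ≤ h s}))
    (hM : weightedChoquet ω h ≤ ENNReal.ofReal M)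
    (hD : ENNReal.ofReal M < ENNReal.ofReal (c / 2) * weightPrimitive ω (ENNReal.ofReal D)) :
    weightedChoquet ω (Sᶜ.indicator h) + ENNReal.ofReal (c / 2) * ENNReal.ofReal (m * ω D) ≤
      weightedChoquet ω h := by
  have hc2 : 0 < c / 2 := by positivity
  have hdist : ∀ θ ∈ Ioo (c / 2) c, halfDist h θ < ENNReal.ofReal D := by
    intro θ hθ
    by_contra! hcon
    refine (hM.trans_lt hD).not_ge ?_
    calc ENNReal.ofReal (c / 2) * weightPrimitive ω (ENNReal.ofReal D)
        = ∫⁻ _ in Ioc 0 (c / 2), weightPrimitive ω (ENNReal.ofReal D) := by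
          rw [setLIntegral_const, Real.volume_Ioc, sub_zero, mul_comm]
      _ ≤ ∫⁻ τ in Ioc 0 (c / 2), weightPrimitive ω (halfDist h τ) :=
          setLIntegral_mono' measurableSet_Ioc fun τ hτ => weightPrimitive_mono ω
            (hcon.trans (halfDist_antitone h (hτ.2.trans hθ.1.le)))
      _ ≤ weightedChoquet ω h := lintegral_mono_set Ioc_subset_Ioi_self
  have hsplit : ∀ θ ∈ Ioo (c / 2) c,
      halfDist (Sᶜ.indicator h) θ + ENNReal.ofReal m ≤ halfDist h θ := by
    intro θ hθ
    have hθ0 : 0 < θ := hc2.trans hθ.1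
    refine (add_le_add le_rfl hmS).trans ?_
    rw [halfDist, ← measure_union]
    · refine measure_mono ?_
      rintro s (hs | hs)
      · by_cases hsS : s ∈ Sᶜ
        · simpa [hsS] using hs
        · exact absurd (mem_ofPred_eq ▸ hs) (by simp [hsS, hθ0.le])
      · exact lt_of_lt_of_le hθ.2 hs.2
    · refine disjoint_left.2 fun s hs hs' => ?_
      have : s ∉ Sᶜ := fun h => h hs'.1
      exact absurd (mem_ofPred_eq ▸ hs) (by simp [this, hθ0.le])
    · exact hS.inter (measurableSet_le measurable_const hh)
  have hconst : ENNReal.ofReal (c / 2) * ENNReal.ofReal (m * ω D) =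
      ∫⁻ θ in Ioi 0, (Ioo (c / 2) c).indicator (fun _ => ENNReal.ofReal (m * ω D)) θ := by
    rw [lintegral_indicator measurableSet_Ioo, Measure.restrict_restrict measurableSet_Ioo,
      inter_eq_left.2 (Ioo_subset_Ioi_self.trans (Ioi_subset_Ioi hc2.le)), setLIntegral_const,
      Real.volume_Ioo, mul_comm]
    congr 2
    ring
  rw [hconst, weightedChoquet, ← lintegral_add_left]
  · refine setLIntegral_mono' measurableSet_Ioi fun θ hθ => ?_
    by_cases hθ' : θ ∈ Ioo (c / 2) c
    · rw [indicator_of_mem hθ']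
      exact weightPrimitive_add_le hω hm (hsplit θ hθ') (hdist θ hθ')
    · rw [indicator_of_notMem hθ', add_zero]
      refine weightPrimitive_mono ω (measure_mono fun s hs => ?_)
      by_cases hsS : s ∈ Sᶜ
      · simpa [hsS] using hs
      · exact absurd (mem_ofPred_eq ▸ hs) (by simp [hsS, le_of_lt (mem_Ioi.1 hθ)])
  · exact ((weightPrimitive_mono ω).comp_antitone (halfDist_antitone _)).measurable

end WeightedChoquet

section Modular

/-- Some level set `{|x| > θ}` on the half-line has finite measure. -/
def HasFiniteLevel (x : ℝ → ℝ) : Prop :=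
  ∃ θ : ℝ, 0 < θ ∧ volume {s ∈ Ici (0 : ℝ) | θ < |x s|} ≠ ⊤

lemma HasFiniteLevel.const_mul {x : ℝ → ℝ} (hx : HasFiniteLevel x) {k : ℝ} (hk : 0 < k) :
    HasFiniteLevel fun s => k * x s := by
  obtain ⟨θ, hθ, h⟩ := hx
  refine ⟨k * θ, by positivity, ?_⟩
  simpa only [abs_mul, abs_of_pos hk, mul_lt_mul_iff_right₀ hk] using h

lemma HasFiniteLevel.of_abs_le {u v y : ℝ → ℝ} (hu : HasFiniteLevel u) (hv : HasFiniteLevel v)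
    (h : ∀ s, |y s| ≤ |u s| + 2 * |v s|) : HasFiniteLevel y := by
  obtain ⟨a, ha, hau⟩ := hu
  obtain ⟨b, hb, hbv⟩ := hv
  refine ⟨a + 2 * b, by positivity, ?_⟩
  refine ne_top_of_le_ne_top (ENNReal.add_ne_top.2 ⟨hau, hbv⟩)
    ((measure_mono fun s hs => ?_).trans (measure_union_le _ _))
  by_contra hc
  have h1 : ¬ a < |u s| := fun h' => hc (Or.inl ⟨hs.1, h'⟩)
  have h2 : ¬ b < |v s| := fun h' => hc (Or.inr ⟨hs.1, h'⟩)
  have h3 := hs.2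
  have := h s
  linarith

lemma measurableSet_level {x : ℝ → ℝ} (hx : Measurable x) (θ : ℝ) :
    MeasurableSet {s ∈ Ici (0 : ℝ) | θ < |x s|} :=
  measurableSet_Ici.inter (measurableSet_lt measurable_const hx.abs)

lemma rearr_set_nonempty {x : ℝ → ℝ} (hx : Measurable x) (hf : HasFiniteLevel x) {t : ℝ}
    (ht : 0 < t) :
    {θ : ℝ | 0 < θ ∧ volume {s ∈ Ici (0 : ℝ) | θ < |x s|} ≤ ENNReal.ofReal t}.Nonempty := by
  obtain ⟨θ, hθ, h⟩ := hf
  have hlim := tendsto_measure_iInter_atTop (μ := volume)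
    (s := fun n : ℕ => {s ∈ Ici (0 : ℝ) | θ + n < |x s|})
    (fun n => (measurableSet_level hx _).nullMeasurableSet)
    (fun m n hmn s hs => ⟨hs.1, lt_of_le_of_lt (by gcongr) hs.2⟩) ⟨0, by simpa using h⟩
  have he : ⋂ n : ℕ, {s ∈ Ici (0 : ℝ) | θ + n < |x s|} = ∅ := by
    refine eq_empty_of_forall_notMem fun s hs => ?_
    obtain ⟨n, hn⟩ := exists_nat_gt |x s|
    have := (mem_iInter.1 hs n).2
    linarith
  rw [he, measure_empty] at hlim
  obtain ⟨n, hn⟩ := (hlim.eventually_le_const (ENNReal.ofReal_pos.2 ht)).exists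
  exact ⟨θ + n, by positivity, hn⟩

lemma lt_rearr_iff {x : ℝ → ℝ} (hx : Measurable x) (hf : HasFiniteLevel x) {t τ : ℝ}
    (ht : 0 < t) (hτ : 0 < τ) :
    τ < rearr (Ici 0) x t ↔ ENNReal.ofReal t < volume {s ∈ Ici (0 : ℝ) | τ < |x s|} := by
  rw [← not_le, ← not_le, not_iff_not]
  refine ⟨fun h => ?_, fun h => csInf_le ⟨0, fun θ hθ => hθ.1.le⟩ ⟨hτ, h⟩⟩
  have hU : {s ∈ Ici (0 : ℝ) | τ < |x s|} =
      ⋃ n : ℕ, {s ∈ Ici (0 : ℝ) | τ + 1 / ((n : ℝ) + 1) < |x s|} := by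
    ext s
    simp only [mem_iUnion]
    constructor
    · intro hs
      obtain ⟨n, hn⟩ := exists_nat_one_div_lt (sub_pos.2 hs.2)
      exact ⟨n, hs.1, by linarith⟩
    · rintro ⟨n, hs⟩
      have : 0 < 1 / ((n : ℝ) + 1) := by positivity
      exact ⟨hs.1, by linarith [hs.2]⟩
  rw [hU, Monotone.measure_iUnion]
  · refine iSup_le fun n => ?_
    have hpos : 0 < 1 / ((n : ℝ) + 1) := by positivity
    obtain ⟨θ, hθ, hlt⟩ := exists_lt_of_csInf_lt (rearr_set_nonempty hx hf ht)
      (show rearr (Ici 0) x t < τ + 1 / ((n : ℝ) + 1) by linarith)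
    have hsub : {s ∈ Ici (0 : ℝ) | τ + 1 / ((n : ℝ) + 1) < |x s|} ⊆ {s ∈ Ici (0 : ℝ) | θ < |x s|} :=
      fun s hs => ⟨hs.1, hlt.trans hs.2⟩
    exact (measure_mono hsub).trans hθ.2
  · intro m n hmn s hs
    exact ⟨hs.1, lt_of_le_of_lt (by gcongr) hs.2⟩

lemma rearr_antitoneOn {x : ℝ → ℝ} (hx : Measurable x) (hf : HasFiniteLevel x) :
    AntitoneOn (rearr (Ici 0) x) (Ioi 0) := fun _ hs _ _ hst =>
  csInf_le_csInf ⟨0, fun _ hθ => hθ.1.le⟩ (rearr_set_nonempty hx hf hs)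
    fun _ hθ => ⟨hθ.1, hθ.2.trans (ENNReal.ofReal_le_ofReal hst)⟩

lemma rearr_nonneg (x : ℝ → ℝ) (t : ℝ) : 0 ≤ rearr (Ici 0) x t :=
  Real.sInf_nonneg fun _ hθ => hθ.1.le

lemma olModular_eq_weightedChoquet {φ ω x : ℝ → ℝ} (hφ : IsOrliczFunction φ) (hω : Antitone ω)
    (hx : Measurable x) (hf : HasFiniteLevel x) :
    olModular (Ici 0) φ ω x = weightedChoquet ω fun s => φ (x s) := by
  have hφ0 := hφ.2.2.2.2.1
  have hmono : AntitoneOn (fun t => φ (rearr (Ici 0) x t)) (Ioi 0) := fun s hs t ht hst =>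
    hφ.map_le_map (abs_le_abs_of_nonneg (rearr_nonneg x t) (rearr_antitoneOn hx hf hs ht hst))
  have hae : AEMeasurable (fun t => φ (rearr (Ici 0) x t)) (volume.restrict (Ioi 0)) :=
    aemeasurable_restrict_of_antitoneOn measurableSet_Ioi hmono
  have hωm : Measurable fun t => ENNReal.ofReal (ω t) := hω.measurable.ennreal_ofReal
  set ν := (volume.restrict (Ioi (0 : ℝ))).withDensity fun t => ENNReal.ofReal (ω t) with hν
  have h1 : olModular (Ici 0) φ ω x = ∫⁻ t, ENNReal.ofReal (φ (rearr (Ici 0) x t)) ∂ν := by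
    rw [hν, lintegral_withDensity_eq_lintegral_mul₀ hωm.aemeasurable hae.ennreal_ofReal, olModular,
      setLIntegral_congr Ioi_ae_eq_Ici.symm]
    refine lintegral_congr fun t => ?_
    rw [ENNReal.ofReal_mul (hφ0 _), Pi.mul_apply, mul_comm]
  rw [h1, lintegral_eq_lintegral_meas_lt _ (Eventually.of_forall fun _ => hφ0 _)
    (hae.mono_ac (withDensity_absolutelyContinuous _ _)), weightedChoquet]
  refine setLIntegral_congr_fun measurableSet_Ioi fun θ hθ => ?_
  obtain ⟨τ, hτ, rfl⟩ := hφ.exists_preimage hθ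
  have hset : ∀ t ∈ Ioi (0 : ℝ), (φ τ < φ (rearr (Ici 0) x t) ↔
      ENNReal.ofReal t < halfDist (fun s => φ (x s)) (φ τ)) := by
    intro t ht
    rw [hφ.lt_map_iff hτ, abs_of_nonneg (rearr_nonneg x t), lt_rearr_iff hx hf ht hτ, halfDist,
      Measure.restrict_apply (show MeasurableSet {s | φ τ < φ (x s)} from
        measurableSet_lt measurable_const (hφ.continuous.measurable.comp hx)), inter_comm]
    simp only [hφ.lt_map_iff hτ]
    rfl
  set d := halfDist (fun s => φ (x s)) (φ τ)
  have hT : {t : ℝ | 0 < t ∧ ENNReal.ofReal t < d} =ᵐ[volume]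
      {t : ℝ | 0 ≤ t ∧ ENNReal.ofReal t < d} :=
    (Ioi_ae_eq_Ici (μ := volume) (a := (0 : ℝ))).inter (ae_eq_refl _)
  have hTm : MeasurableSet {t : ℝ | ENNReal.ofReal t < d} :=
    measurableSet_lt ENNReal.measurable_ofReal measurable_const
  rw [weightPrimitive, ← setLIntegral_congr hT]
  have hν' : ν {a | φ τ < φ (rearr (Ici 0) x a)} = ν {t : ℝ | ENNReal.ofReal t < d} := by
    refine measure_congr ?_
    have : ∀ᵐ t ∂ν, t ∈ Ioi (0 : ℝ) :=
      (withDensity_absolutelyContinuous _ _).ae_le (ae_restrict_mem measurableSet_Ioi)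
    filter_upwards [this] with t ht
    exact propext (hset t ht)
  rw [hν', hν, withDensity_apply _ hTm, Measure.restrict_restrict hTm, inter_comm]
  rfl

lemma olModular_eq_zero_of_not_hasFiniteLevel {φ ω x : ℝ → ℝ} (hφ : IsOrliczFunction φ)
    (hf : ¬ HasFiniteLevel x) : olModular (Ici 0) φ ω x = 0 := by
  have : ∀ t, rearr (Ici 0) x t = 0 := by
    intro t
    have : {θ : ℝ | 0 < θ ∧ volume {s ∈ Ici (0 : ℝ) | θ < |x s|} ≤ ENNReal.ofReal t} = ∅ :=
      eq_empty_of_forall_notMem fun θ hθ =>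
        hf ⟨θ, hθ.1, ne_top_of_le_ne_top ENNReal.ofReal_ne_top hθ.2⟩
    rw [rearr, this, Real.sInf_empty]
  simp [olModular, this, hφ.2.2.1]

lemma olModular_le_weightedChoquet {φ ω x : ℝ → ℝ} (hφ : IsOrliczFunction φ) (hω : Antitone ω)
    (hx : Measurable x) : olModular (Ici 0) φ ω x ≤ weightedChoquet ω fun s => φ (x s) := by
  by_cases hf : HasFiniteLevel x
  · exact (olModular_eq_weightedChoquet hφ hω hx hf).le
  · simp [olModular_eq_zero_of_not_hasFiniteLevel hφ hf]

lemma orliczNorm_eq_zero {φ ω x : ℝ → ℝ}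
    (h : ∀ k : ℝ, 0 < k → olModular (Ici 0) φ ω (fun s => k * x s) = 0) :
    orliczNorm (Ici 0) φ ω x = 0 := by
  refine le_antisymm (ENNReal.le_of_forall_pos_le_add fun ε hε _ => ?_) zero_le
  have hε' : (0 : ℝ) < ε := hε
  refine (iInf₂_le (ε : ℝ)⁻¹ (inv_pos.2 hε')).trans ?_
  rw [h _ (inv_pos.2 hε'), add_zero, zero_add, ENNReal.ofReal_inv_of_pos hε', one_div, inv_inv,
    ENNReal.ofReal_coe_nnreal]

lemma orliczNorm_eq_zero_of_not_hasFiniteLevel {φ ω x : ℝ → ℝ} (hφ : IsOrliczFunction φ)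
    (hf : ¬ HasFiniteLevel x) : orliczNorm (Ici 0) φ ω x = 0 := by
  refine orliczNorm_eq_zero fun k hk =>
    olModular_eq_zero_of_not_hasFiniteLevel hφ fun hk' => hf ?_
  simpa [hk.ne'] using hk'.const_mul (inv_pos.2 hk)

lemma exists_modular_le_of_orliczNorm_lt {D : Set ℝ} {φ ω x : ℝ → ℝ} {A : ℝ}
    (h : orliczNorm D φ ω x < ENNReal.ofReal A) :
    ∃ k, 0 < k ∧ 1 + olModular D φ ω (fun s => k * x s) ≤ ENNReal.ofReal (A * k) := by
  simp only [orliczNorm, iInf_lt_iff] at h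
  obtain ⟨k, hk, h⟩ := h
  have hk : 0 < k := hk
  refine ⟨k, hk, ?_⟩
  rw [mul_comm, ENNReal.ofReal_mul hk.le, mul_comm]
  exact (ENNReal.div_le_iff (ENNReal.ofReal_pos.2 hk).ne' ENNReal.ofReal_ne_top).1 h.le

lemma orliczNorm_le_ofReal {D : Set ℝ} {φ ω x : ℝ → ℝ} {k r A : ℝ} (hk : 0 < k)
    (hr : olModular D φ ω (fun s => k * x s) ≤ ENNReal.ofReal r) (hr0 : 0 ≤ r)
    (h : (1 + r) / k ≤ A) : orliczNorm D φ ω x ≤ ENNReal.ofReal A := by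
  refine (iInf₂_le k hk).trans (le_trans ?_ (ENNReal.ofReal_le_ofReal h))
  rw [ENNReal.ofReal_div_of_pos hk, ENNReal.ofReal_add zero_le_one hr0, ENNReal.ofReal_one]
  gcongr

lemma modular_real_bound {D : Set ℝ} {φ ω z : ℝ → ℝ} {R : ℝ}
    (h : 1 + olModular D φ ω z ≤ ENNReal.ofReal R) :
    ∃ p, 0 ≤ p ∧ olModular D φ ω z = ENNReal.ofReal p ∧ 1 + p ≤ R := by
  have hne : olModular D φ ω z ≠ ⊤ :=
    ne_top_of_le_ne_top ENNReal.ofReal_ne_top (le_add_self.trans h)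
  refine ⟨(olModular D φ ω z).toReal, ENNReal.toReal_nonneg, (ENNReal.ofReal_toReal hne).symm, ?_⟩
  rw [← ENNReal.ofReal_toReal hne, ← ENNReal.ofReal_one,
    ← ENNReal.ofReal_add zero_le_one ENNReal.toReal_nonneg] at h
  exact (ENNReal.ofReal_le_ofReal_iff' .. |>.1 h).resolve_right fun hc => by
    linarith [ENNReal.toReal_nonneg (a := olModular D φ ω z)]

end Modular

section LocallyUniformlyNonsquare

variable {φ ω : ℝ → ℝ}

lemma IsOrliczFunction.map_convex_comb_sub_le (hφ : IsOrliczFunction φ) {α β : ℝ} (hα : 0 ≤ α)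
    (hβ : 0 ≤ β) (hαβ : α + β = 1) (a b : ℝ) : φ (α * a - β * b) ≤ α * φ a + β * φ b := by
  have := hφ.1.2 (mem_univ a) (mem_univ (-b)) hα hβ hαβ
  rw [hφ.2.1] at this
  simpa [sub_eq_add_neg] using this

lemma IsOrliczFunction.map_convex_comb_sub_le_of_mul_nonneg (hφ : IsOrliczFunction φ)
    {α β η a b : ℝ} (hα : 0 ≤ α) (hβ : 0 ≤ β) (hη : 0 ≤ η) (ha : φ (α * a) ≤ η * (α * φ a))
    (hb : φ (β * b) ≤ η * (β * φ b)) (hab : 0 ≤ a * b) :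
    φ (α * a - β * b) ≤ η * (α * φ a + β * φ b) := by
  have h : |α * a - β * b| ≤ max |α * a| |β * b| := by
    have hp : 0 ≤ (α * a) * (β * b) := by
      have : 0 ≤ (α * β) * (a * b) := by positivity
      linarith
    generalize α * a = p at *
    generalize β * b = q at *
    rcases abs_cases p with h1 | h1 <;> rcases abs_cases q with h2 | h2 <;>
      rcases abs_cases (p - q) with h3 | h3 <;> rw [h1.1, h2.1, h3.1, le_max_iff] <;>
      by_contra! hc <;> nlinarith
  have h1 : 0 ≤ η * (α * φ a) := mul_nonneg hη (mul_nonneg hα (hφ.2.2.2.2.1 _))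
  have h2 : 0 ≤ η * (β * φ b) := mul_nonneg hη (mul_nonneg hβ (hφ.2.2.2.2.1 _))
  rcases le_max_iff.1 h with h | h
  · linarith [hφ.map_le_map h]
  · linarith [hφ.map_le_map h]

lemma weightedChoquet_convex_comb_le (hω : Antitone ω) (hω0 : ∀ t, 0 ≤ ω t) {u v : ℝ → ℝ}
    (hu : Measurable u) (hv : Measurable v) {α β p q : ℝ} (hα : 0 < α) (hβ : 0 < β)
    (hp : 0 ≤ p) (hq : 0 ≤ q)
    (hup : weightedChoquet ω u ≤ ENNReal.ofReal p) (hvq : weightedChoquet ω v ≤ ENNReal.ofReal q) :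
    weightedChoquet ω (fun s => α * u s + β * v s) ≤ ENNReal.ofReal (α * p + β * q) := by
  refine (weightedChoquet_add_le hω hω0 (hu.const_mul α) (hv.const_mul β)).trans ?_
  rw [weightedChoquet_const_mul ω u hα, weightedChoquet_const_mul ω v hβ,
    ENNReal.ofReal_add (by positivity) (by positivity), ENNReal.ofReal_mul hα.le,
    ENNReal.ofReal_mul hβ.le]
  gcongr

/-- A gain `G` in the convexity inequality for the modular is a gain in the triangle inequality
for the Orlicz norm. -/
lemma orliczNorm_half_sub_le (hφ : IsOrliczFunction φ) (hω : Antitone ω) (hω0 : ∀ t, 0 ≤ ω t)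
    {x y : ℝ → ℝ} (hx : Measurable x) (hy : Measurable y) (hfx : HasFiniteLevel x)
    (hfy : HasFiniteLevel y) {k l A B G : ℝ} (hk : 0 < k) (hl : 0 < l) (hG : 0 ≤ G)
    (hkx : 1 + olModular (Ici 0) φ ω (fun s => k * x s) ≤ ENNReal.ofReal (A * k))
    (hly : 1 + olModular (Ici 0) φ ω (fun s => l * y s) ≤ ENNReal.ofReal (B * l))
    (hgain : weightedChoquet ω
        (fun s => φ (l / (k + l) * (k * x s) - k / (k + l) * (l * y s))) + ENNReal.ofReal G ≤
      weightedChoquet ω (fun s => l / (k + l) * φ (k * x s) + k / (k + l) * φ (l * y s))) :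
    orliczNorm (Ici 0) φ ω (fun s => (x s - y s) / 2) ≤
      ENNReal.ofReal ((A + B) / 2 - G / (2 * k)) := by
  have hφm : Measurable φ := hφ.continuous.measurable
  obtain ⟨p, hp0, hp, hpA⟩ := modular_real_bound hkx
  obtain ⟨q, hq0, hq, hqB⟩ := modular_real_bound hly
  rw [olModular_eq_weightedChoquet hφ hω (hx.const_mul k) (hfx.const_mul hk)] at hp
  rw [olModular_eq_weightedChoquet hφ hω (hy.const_mul l) (hfy.const_mul hl)] at hq
  have hkl : 0 < k + l := by positivity
  have h1 := hgain.trans (weightedChoquet_convex_comb_le hω hω0 (hφm.comp (hx.const_mul k))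
    (hφm.comp (hy.const_mul l)) (div_pos hl hkl) (div_pos hk hkl) hp0 hq0 hp.le hq.le)
  set W := weightedChoquet ω (fun s => φ (l / (k + l) * (k * x s) - k / (k + l) * (l * y s)))
    with hW
  have hWne : W ≠ ⊤ := ne_top_of_le_ne_top ENNReal.ofReal_ne_top (le_self_add.trans h1)
  rw [← ENNReal.ofReal_toReal hWne, ← ENNReal.ofReal_add ENNReal.toReal_nonneg hG,
    ENNReal.ofReal_le_ofReal_iff (by positivity)] at h1
  have hmod : olModular (Ici 0) φ ω (fun s => 2 * k * l / (k + l) * ((x s - y s) / 2)) ≤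
      ENNReal.ofReal W.toReal := by
    rw [ENNReal.ofReal_toReal hWne, hW]
    refine (olModular_le_weightedChoquet hφ hω (by fun_prop)).trans_eq ?_
    congr 1
    funext s
    congr 1
    field_simp
  refine orliczNorm_le_ofReal (by positivity) hmod ENNReal.toReal_nonneg ?_
  rw [div_le_iff₀ (by positivity)]
  have e1 : ((A + B) / 2 - G / (2 * k)) * (2 * k * l / (k + l)) =
      l / (k + l) * (A * k) + k / (k + l) * (B * l) - G * (l / (k + l)) := by
    field_simp
  have e2 : l / (k + l) + k / (k + l) = 1 := by field_simp; ring
  have e3 : G * (l / (k + l)) ≤ G := by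
    refine mul_le_of_le_one_right hG ((div_le_one hkl).2 (by linarith))
  rw [e1]
  have e4 := mul_le_mul_of_nonneg_left hpA (div_pos hl hkl).le
  have e5 := mul_le_mul_of_nonneg_left hqB (div_pos hk hkl).le
  linarith

/-- If `l` almost realizes the Orlicz norm of `y`, then `l` is bounded unless the norm is small. -/
lemma orliczNorm_le_half (hφ : IsOrliczFunction φ) (hω : Antitone ω) {η : ℝ} (hη : 0 < η)
    (hφη : ∀ u, φ (1 / 2 * u) ≤ η * (1 / 2 * φ u)) {n : ℕ} (hn : 8 * η ^ n ≤ 1) {y : ℝ → ℝ}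
    (hy : Measurable y) {l : ℝ} (hl : 4 * 2 ^ n < l)
    (hly : 1 + olModular (Ici 0) φ ω (fun s => l * y s) ≤ ENNReal.ofReal (2 * l)) :
    orliczNorm (Ici 0) φ ω y ≤ ENNReal.ofReal (1 / 2) := by
  by_cases hf : HasFiniteLevel y
  swap
  · simp [orliczNorm_eq_zero_of_not_hasFiniteLevel hφ hf]
  have h2n : (0 : ℝ) < 2 ^ n := by positivity
  have hl0 : 0 < l := by linarith
  obtain ⟨q, hq0, hq, hql⟩ := modular_real_bound hly
  have hiter : ∀ (n : ℕ) (u : ℝ), φ (u / 2 ^ n) ≤ (η / 2) ^ n * φ u := by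
    intro n
    induction n with
    | zero => simp
    | succ n ih =>
      intro u
      calc φ (u / 2 ^ (n + 1)) = φ (1 / 2 * (u / 2 ^ n)) := by congr 1; rw [pow_succ]; field_simp
        _ ≤ η * (1 / 2 * φ (u / 2 ^ n)) := hφη _
        _ ≤ η * (1 / 2 * ((η / 2) ^ n * φ u)) := by gcongr; exact ih u
        _ = (η / 2) ^ (n + 1) * φ u := by ring
  rw [olModular_eq_weightedChoquet hφ hω (hy.const_mul l) (hf.const_mul hl0)] at hq
  have hmod : olModular (Ici 0) φ ω (fun s => l / 2 ^ n * y s) ≤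
      ENNReal.ofReal ((η / 2) ^ n * q) := by
    rw [ENNReal.ofReal_mul (by positivity), ← hq,
      ← weightedChoquet_const_mul ω _ (by positivity : 0 < (η / 2) ^ n)]
    refine (olModular_le_weightedChoquet hφ hω (hy.const_mul _)).trans
      (weightedChoquet_mono ω fun s => ?_)
    rw [div_mul_eq_mul_div]
    exact hiter n _
  refine orliczNorm_le_ofReal (by positivity) hmod (by positivity) ?_
  rw [div_le_iff₀ (by positivity), div_pow]
  have h3 : η ^ n / 2 ^ n * q ≤ 1 / 8 / 2 ^ n * (2 * l) := by
    gcongr <;> linarith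
  have h4 : 1 / 8 / 2 ^ n * (2 * l) = 1 / 4 * (l / 2 ^ n) := by ring
  have h5 : 4 < l / 2 ^ n := by rwa [lt_div_iff₀ h2n]
  linarith

/-- The gain in the convexity inequality for the modular when `x` and `y` have the same sign on a
large part of the set where `x` is large. -/
lemma modular_gain (hφ : IsOrliczFunction φ) (hω : Antitone ω) (hω0 : ∀ t, 0 ≤ ω t)
    {u v : ℝ → ℝ} (hu : Measurable u) (hv : Measurable v) {α β η : ℝ} (hα : 0 < α) (hβ : 0 < β)
    (hαβ : α + β = 1) (hη : 0 < η) (hη1 : η < 1) (hφα : ∀ w, φ (α * w) ≤ η * (α * φ w))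
    (hφβ : ∀ w, φ (β * w) ≤ η * (β * φ w)) {c m D M : ℝ} (hc : 0 < c) (hm : 0 ≤ m)
    (hS : ENNReal.ofReal m ≤
      volume.restrict (Ici 0) ({s | 0 ≤ u s * v s} ∩ {s | c ≤ α * φ (u s)}))
    (hM : weightedChoquet ω (fun s => α * φ (u s) + β * φ (v s)) ≤ ENNReal.ofReal M)
    (hD : ENNReal.ofReal M < ENNReal.ofReal (c / 2) * weightPrimitive ω (ENNReal.ofReal D)) :
    weightedChoquet ω (fun s => φ (α * u s - β * v s)) +
        ENNReal.ofReal ((1 - η) * (c / 2 * (m * ω D))) ≤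
      weightedChoquet ω (fun s => α * φ (u s) + β * φ (v s)) := by
  have hφm : Measurable φ := hφ.continuous.measurable
  have hφ0 := hφ.2.2.2.2.1
  set h : ℝ → ℝ := fun s => α * φ (u s) + β * φ (v s) with hh
  have hhm : Measurable h := by fun_prop
  set S := {s | 0 ≤ u s * v s} with hSdef
  have hSm : MeasurableSet S := measurableSet_le measurable_const (hu.mul hv)
  have hS' : ENNReal.ofReal m ≤ volume.restrict (Ici 0) (S ∩ {s | c ≤ h s}) :=
    hS.trans (measure_mono fun s hs => ⟨hs.1, hs.2.trans
      (le_add_of_nonneg_right (mul_nonneg hβ.le (hφ0 _)))⟩)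
  have hgap := weightedChoquet_indicator_add_le hω hhm hSm hc hm hS' hM hD
  have hpt : ∀ s, φ (α * u s - β * v s) ≤ η * h s + (1 - η) * Sᶜ.indicator h s := by
    intro s
    by_cases hs : s ∈ S
    · rw [indicator_of_notMem (fun h : s ∈ Sᶜ => h hs), mul_zero, add_zero]
      exact hφ.map_convex_comb_sub_le_of_mul_nonneg hα.le hβ.le hη.le (hφα _) (hφβ _) hs
    · rw [indicator_of_mem hs, ← add_mul, add_sub_cancel, one_mul]
      exact hφ.map_convex_comb_sub_le hα.le hβ.le hαβ _ _
  have hη' : 0 < 1 - η := by linarith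
  calc _ ≤ (ENNReal.ofReal η * weightedChoquet ω h +
        ENNReal.ofReal (1 - η) * weightedChoquet ω (Sᶜ.indicator h)) +
        ENNReal.ofReal ((1 - η) * (c / 2 * (m * ω D))) := by
        gcongr
        refine (weightedChoquet_mono ω hpt).trans ((weightedChoquet_add_le hω hω0
          (hhm.const_mul _) ((hhm.indicator hSm.compl).const_mul _)).trans_eq ?_)
        rw [weightedChoquet_const_mul ω h hη, weightedChoquet_const_mul ω _ hη']
    _ = ENNReal.ofReal η * weightedChoquet ω h + ENNReal.ofReal (1 - η) *
        (weightedChoquet ω (Sᶜ.indicator h) +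
          ENNReal.ofReal (c / 2) * ENNReal.ofReal (m * ω D)) := by
        rw [ENNReal.ofReal_mul hη'.le, ENNReal.ofReal_mul (by positivity : 0 ≤ c / 2), mul_add,
          add_assoc]
    _ ≤ ENNReal.ofReal η * weightedChoquet ω h + ENNReal.ofReal (1 - η) * weightedChoquet ω h := by
        gcongr
    _ = weightedChoquet ω h := by
        rw [← add_mul, ← ENNReal.ofReal_add hη.le hη'.le, add_sub_cancel, ENNReal.ofReal_one,
          one_mul]

lemma exists_lt_weightPrimitive (hωint : (∫⁻ t in Ici (0 : ℝ), ENNReal.ofReal (ω t)) = ⊤)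
    {B : ℝ≥0∞} (hB : B ≠ ⊤) : ∃ D, 0 ≤ D ∧ B < weightPrimitive ω (ENNReal.ofReal D) := by
  have hU : Ici (0 : ℝ) = ⋃ n : ℕ, {t : ℝ | 0 ≤ t ∧ ENNReal.ofReal t < ENNReal.ofReal n} := by
    ext t
    simp only [mem_iUnion, mem_Ici]
    constructor
    · intro ht
      obtain ⟨n, hn⟩ := exists_nat_gt t
      exact ⟨n, ht, (ENNReal.ofReal_lt_ofReal_iff_of_nonneg ht).2 hn⟩
    · rintro ⟨n, hn⟩
      exact hn.1
  have hmono : Monotone fun n : ℕ => {t : ℝ | 0 ≤ t ∧ ENNReal.ofReal t < ENNReal.ofReal n} :=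
    fun a b hab t ht => ⟨ht.1, ht.2.trans_le (ENNReal.ofReal_le_ofReal (by exact_mod_cast hab))⟩
  rw [hU, setLIntegral_iUnion_of_directed _ hmono.directed_le] at hωint
  obtain ⟨n, hn⟩ := lt_iSup_iff.1 (hωint ▸ hB.lt_top)
  exact ⟨n, by positivity, hn⟩

lemma olModular_neg (φ ω x : ℝ → ℝ) (k : ℝ) :
    olModular (Ici 0) φ ω (fun s => k * -x s) = olModular (Ici 0) φ ω (fun s => k * x s) := by
  simp only [olModular, rearr, mul_neg, abs_neg]

lemma exists_level_of_orliczNorm_ne_zero (hφ : IsOrliczFunction φ) {x : ℝ → ℝ} (hx : Measurable x)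
    (hω : Antitone ω) (hne : orliczNorm (Ici 0) φ ω x ≠ 0) :
    ∃ c m : ℝ, 0 < c ∧ 0 < m ∧
      ENNReal.ofReal (2 * m) ≤ volume.restrict (Ici 0) {s | c < |x s|} := by
  have hpos : ∃ c : ℝ, 0 < c ∧ volume.restrict (Ici 0) {s | c < |x s|} ≠ 0 := by
    by_contra! hcon
    refine hne (orliczNorm_eq_zero fun k hk => le_antisymm
      ((olModular_le_weightedChoquet hφ hω (hx.const_mul k)).trans_eq ?_) zero_le)
    have : ∀ θ ∈ Ioi (0 : ℝ), weightPrimitive ω (halfDist (fun s => φ (k * x s)) θ) = 0 := by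
      intro θ hθ
      obtain ⟨τ, hτ, rfl⟩ := hφ.exists_preimage hθ
      have : halfDist (fun s => φ (k * x s)) (φ τ) = 0 := by
        simp only [halfDist, hφ.lt_map_iff hτ, abs_mul, abs_of_pos hk, ← div_lt_iff₀' hk]
        exact hcon _ (by positivity)
      simp [this, weightPrimitive]
    rw [weightedChoquet, setLIntegral_congr_fun measurableSet_Ioi this, lintegral_zero]
  obtain ⟨c, hc, h⟩ := hpos
  obtain ⟨m, hm, hlt⟩ := ENNReal.lt_iff_exists_nnreal_btwn.1 (pos_iff_ne_zero.2 h)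
  have hm : (0 : ℝ) < m := by exact_mod_cast hm
  refine ⟨c, m / 2, hc, by positivity, ?_⟩
  rw [mul_div_cancel₀ _ two_ne_zero, ENNReal.ofReal_coe_nnreal]
  exact hlt.le

theorem exists_delta_of_antitone (hφ : IsOrliczFunction φ) (hω : Antitone ω) (hω0 : ∀ t, 0 < ω t)
    (hψ : Delta2All (complementaryFn φ))
    (hωint : (∫⁻ t in Ici (0 : ℝ), ENNReal.ofReal (ω t)) = ⊤)
    {x : ℝ → ℝ} (hx : Measurable x) (hxn : orliczNorm (Ici 0) φ ω x = 1) :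
    ∃ δ ∈ Ioo (0 : ℝ) 1, ∀ y : ℝ → ℝ, Measurable y → orliczNorm (Ici 0) φ ω y ≤ 1 →
      min (orliczNorm (Ici 0) φ ω (fun t => (x t - y t) / 2))
          (orliczNorm (Ici 0) φ ω (fun t => (x t + y t) / 2)) ≤ ENNReal.ofReal (1 - δ) := by
  have hω0' : ∀ t, 0 ≤ ω t := fun t => (hω0 t).le
  have hφm : Measurable φ := hφ.continuous.measurable
  have hfx : HasFiniteLevel x := by
    by_contra hf
    rw [orliczNorm_eq_zero_of_not_hasFiniteLevel hφ hf] at hxn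
    exact zero_ne_one hxn
  obtain ⟨c, m, hc, hm, hcm⟩ := exists_level_of_orliczNorm_ne_zero hφ hx hω (by simp [hxn])
  obtain ⟨ζ, ⟨hζ0, hζ1⟩, hζ⟩ := hφ.exists_contraction hψ one_half_pos le_rfl
  obtain ⟨n, hn⟩ := exists_pow_lt_of_lt_one (by norm_num : (0 : ℝ) < 1 / 8) hζ1
  have hζ' : ∀ u, φ (1 / 2 * u) ≤ ζ * (1 / 2 * φ u) := fun u =>
    hζ (1 / 2) u (by norm_num) (by norm_num)
  set L : ℝ := 4 * 2 ^ n with hLdef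
  have hL : 4 ≤ L := by linarith [one_le_pow₀ (M₀ := ℝ) one_le_two (n := n)]
  set a₀ : ℝ := 1 / (2 * L + 1) with ha₀def
  have ha₀ : 0 < a₀ := by positivity
  have ha₀' : a₀ ≤ 1 / 2 := one_div_le_one_div_of_le (by norm_num) (by linarith)
  obtain ⟨η, ⟨hη0, hη1⟩, hη⟩ := hφ.exists_contraction hψ ha₀ ha₀'
  have hratio : ∀ k l : ℝ, 1 / 2 ≤ k → k ≤ L → 1 / 2 ≤ l → l ≤ L → a₀ ≤ l / (k + l) := by
    intro k l hk hk' hl hl'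
    rw [ha₀def, div_le_div_iff₀ (by positivity) (by positivity)]
    nlinarith
  set c' := a₀ * φ (c / 2) with hc'def
  have hc' : 0 < c' := mul_pos ha₀ (hφ.2.2.2.1 _ (by positivity))
  have hc2 : ENNReal.ofReal (c' / 2) ≠ 0 := (ENNReal.ofReal_pos.2 (by positivity)).ne'
  obtain ⟨D, -, hD⟩ := exists_lt_weightPrimitive hωint
    (B := ENNReal.ofReal (2 * L) / ENNReal.ofReal (c' / 2))
    (ENNReal.div_ne_top ENNReal.ofReal_ne_top hc2)
  rw [ENNReal.div_lt_iff (Or.inl hc2) (Or.inl ENNReal.ofReal_ne_top),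
    mul_comm (weightPrimitive ω _)] at hD
  set G := (1 - η) * (c' / 2 * (m * ω D)) with hGdef
  have hG : 0 < G := by
    have := hω0 D
    have : 0 < 1 - η := by linarith
    positivity
  set ε := min (1 / 8) (G / (8 * L)) with hεdef
  have hε : 0 < ε := by positivity
  have hε8 : ε ≤ 1 / 8 := min_le_left _ _
  have hεG : ε ≤ G / (8 * L) := min_le_right _ _
  set δ := min (1 / 16) (3 * G / (8 * L)) with hδdef
  have hδ : 0 < δ := by positivity
  have hδ16 : δ ≤ 1 / 16 := min_le_left _ _
  have hδG : δ ≤ 3 * G / (8 * L) := min_le_right _ _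
  have hone : (1 : ℝ≥0∞) < ENNReal.ofReal (1 + ε) := ENNReal.one_lt_ofReal.2 (by linarith)
  have hlow : ∀ {z : ℝ → ℝ} {l : ℝ},
      1 + olModular (Ici 0) φ ω z ≤ ENNReal.ofReal ((1 + ε) * l) → 1 / 2 ≤ l := by
    intro z l h
    obtain ⟨p, hp, -, hpl⟩ := modular_real_bound h
    nlinarith
  have hhigh : ∀ {z : ℝ → ℝ} {l : ℝ}, Measurable z → L < l →
      1 + olModular (Ici 0) φ ω (fun s => l * z s) ≤ ENNReal.ofReal ((1 + ε) * l) →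
      orliczNorm (Ici 0) φ ω z ≤ ENNReal.ofReal (1 / 2) := fun hz hl h =>
    orliczNorm_le_half hφ hω hζ0 hζ' (by linarith) hz hl
      (h.trans (ENNReal.ofReal_le_ofReal (by nlinarith)))
  obtain ⟨k, hk, hkx⟩ := exists_modular_le_of_orliczNorm_lt (hxn.trans_lt hone)
  have hk2 := hlow hkx
  have hkL : k ≤ L := by
    by_contra! hcon
    have := hhigh hx hcon hkx
    rw [hxn, ENNReal.one_le_ofReal] at this
    norm_num at this
  have key : ∀ (z : ℝ → ℝ) (l : ℝ), Measurable z → HasFiniteLevel z → 1 / 2 ≤ l → l ≤ L →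
      1 + olModular (Ici 0) φ ω (fun s => l * z s) ≤ ENNReal.ofReal ((1 + ε) * l) →
      ENNReal.ofReal m ≤ volume.restrict (Ici 0)
        ({s | 0 ≤ k * x s * (l * z s)} ∩ {s | c' ≤ l / (k + l) * φ (k * x s)}) →
      orliczNorm (Ici 0) φ ω (fun t => (x t - z t) / 2) ≤ ENNReal.ofReal (1 - δ) := by
    intro z l hz hfz hl2 hlL hlz hmS
    have hl : 0 < l := by linarith
    have hkl : 0 < k + l := by positivity
    have hα := hratio k l hk2 hkL hl2 hlL
    have hβ := hratio l k hl2 hlL hk2 hkL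
    rw [add_comm l k] at hβ
    have hαβ : l / (k + l) + k / (k + l) = 1 := by field_simp; ring
    have hM : weightedChoquet ω
        (fun s => l / (k + l) * φ (k * x s) + k / (k + l) * φ (l * z s)) ≤
        ENNReal.ofReal (2 * L) := by
      obtain ⟨p, hp0, hp, hpA⟩ := modular_real_bound hkx
      obtain ⟨q, hq0, hq, hqB⟩ := modular_real_bound hlz
      rw [olModular_eq_weightedChoquet hφ hω (hx.const_mul k) (hfx.const_mul hk)] at hp
      rw [olModular_eq_weightedChoquet hφ hω (hz.const_mul l) (hfz.const_mul hl)] at hq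
      refine (weightedChoquet_convex_comb_le hω hω0' (hφm.comp (hx.const_mul k))
        (hφm.comp (hz.const_mul l)) (ha₀.trans_le hα) (ha₀.trans_le hβ) hp0 hq0 hp.le hq.le).trans
        (ENNReal.ofReal_le_ofReal ?_)
      have hp2 : p ≤ 2 * L := by nlinarith
      have hq2 : q ≤ 2 * L := by nlinarith
      calc l / (k + l) * p + k / (k + l) * q
          ≤ l / (k + l) * (2 * L) + k / (k + l) * (2 * L) := by gcongr
        _ = 2 * L := by rw [← add_mul, hαβ, one_mul]
    have hgain := modular_gain hφ hω hω0' (hx.const_mul k) (hz.const_mul l) (ha₀.trans_le hα)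
      (ha₀.trans_le hβ) hαβ hη0 hη1 (fun w => hη _ w (by positivity) (by linarith))
      (fun w => hη _ w (by positivity) (by linarith)) hc' hm.le hmS hM hD
    refine (orliczNorm_half_sub_le hφ hω hω0' hx hz hfx hfz hk hl hG.le hkx hlz hgain).trans
      (ENNReal.ofReal_le_ofReal ?_)
    have h1 : G / (2 * L) ≤ G / (2 * k) := by gcongr
    have h2 : G / (2 * L) = 4 * (G / (8 * L)) := by field_simp; norm_num
    have h3 : 3 * G / (8 * L) = 3 * (G / (8 * L)) := by ring
    linarith
  refine ⟨δ, ⟨hδ, by linarith⟩, fun y hy hyn => ?_⟩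
  by_cases hfy : HasFiniteLevel y
  swap
  · refine min_le_of_left_le ?_
    rw [orliczNorm_eq_zero_of_not_hasFiniteLevel hφ]
    · exact zero_le
    · refine fun hf => hfy (hfx.of_abs_le hf fun s => ?_)
      rw [abs_div, abs_two, mul_div_cancel₀ _ two_ne_zero, abs_sub_comm]
      linarith [abs_sub_abs_le_abs_sub (y s) (x s)]
  obtain ⟨l, hl, hly⟩ := exists_modular_le_of_orliczNorm_lt (hyn.trans_lt hone)
  have hl2 := hlow hly
  rcases lt_or_ge L l with hlL | hlL
  · obtain ⟨j, hj, hjy⟩ := exists_modular_le_of_orliczNorm_lt ((hhigh hy hlL hly).trans_lt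
      ((ENNReal.ofReal_lt_ofReal_iff (by norm_num)).2 (by norm_num : (1 / 2 : ℝ) < 3 / 4)))
    have hkj : 0 < k + j := by positivity
    refine min_le_of_left_le ((orliczNorm_half_sub_le hφ hω hω0' hx hy hfx hfy hk hj le_rfl hkx hjy
      ?_).trans (ENNReal.ofReal_le_ofReal ?_))
    · rw [ENNReal.ofReal_zero, add_zero]
      exact weightedChoquet_mono ω fun s => hφ.map_convex_comb_sub_le (by positivity)
        (by positivity) (by field_simp; ring) _ _
    · rw [zero_div]
      linarith
  set E := {s | c' ≤ l / (k + l) * φ (k * x s)} with hE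
  have hcover : {s | c < |x s|} ⊆
      ({s | 0 ≤ k * x s * (l * y s)} ∩ E) ∪ ({s | 0 ≤ k * x s * (l * -y s)} ∩ E) := by
    intro s hs
    have hs : c < |x s| := hs
    have hsE : s ∈ E := by
      refine mul_le_mul (hratio k l hk2 hkL hl2 hlL) (hφ.map_le_map ?_) (hφ.2.2.2.2.1 _)
        (by positivity)
      rw [abs_of_pos (by positivity), abs_mul, abs_of_pos hk]
      nlinarith
    rcases le_total 0 (k * x s * (l * y s)) with h | h
    · exact Or.inl ⟨h, hsE⟩
    · refine Or.inr ⟨?_, hsE⟩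
      change 0 ≤ k * x s * (l * -y s)
      linarith
  have hsum := hcm.trans ((measure_mono hcover).trans (measure_union_le _ _))
  rw [two_mul, ENNReal.ofReal_add hm.le hm.le] at hsum
  rcases le_or_gt (ENNReal.ofReal m)
    (volume.restrict (Ici 0) ({s | 0 ≤ k * x s * (l * y s)} ∩ E)) with h | h
  · exact min_le_of_left_le (key y l hy hfy hl2 hlL hly h)
  · refine min_le_of_right_le ?_
    have := key (fun s => -y s) l hy.neg (by simpa [HasFiniteLevel] using hfy) hl2 hlL
      (by rwa [olModular_neg]) (le_of_not_gt fun h' => hsum.not_gt (ENNReal.add_lt_add h h'))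
    simpa only [sub_neg_eq_add] using this

end LocallyUniformlyNonsquare

/-- Under `ψ ∈ Δ₂(ℝ)`, `∫₀^∞ ω = ∞` and `ω > 0`, every point of the
unit sphere of `Λ°_{φ,ω}[0,∞)` is a point of local uniform non-squareness. -/
theorem exists_delta_locallyUniformlyNonsquare
    (φ ω : ℝ → ℝ) (hφ : IsOrliczFunction φ) (hω : IsWeight (Set.Ici 0) ω)
    (hψ : Delta2All (complementaryFn φ))
    (hωint : (∫⁻ t in Set.Ici (0:ℝ), ENNReal.ofReal (ω t)) = ⊤)
    (hωpos : ∀ t ∈ Set.Ici (0:ℝ), 0 < ω t)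
    (x : ℝ → ℝ) (hx : MemOL (Set.Ici 0) φ ω x)
    (hxn : orliczNorm (Set.Ici 0) φ ω x = 1) :
    ∃ δ ∈ Set.Ioo (0:ℝ) 1, ∀ y : ℝ → ℝ,
      MemOL (Set.Ici 0) φ ω y → orliczNorm (Set.Ici 0) φ ω y ≤ 1 →
      min (orliczNorm (Set.Ici 0) φ ω (fun t => (x t - y t) / 2))
          (orliczNorm (Set.Ici 0) φ ω (fun t => (x t + y t) / 2))
        ≤ ENNReal.ofReal (1 - δ) := by
  set ω' : ℝ → ℝ := fun t => ω (max t 0) with hω'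
  have hcongr : ∀ t ∈ Ici (0 : ℝ), ω t = ω' t := fun t ht => by
    simp only [hω', max_eq_left (mem_Ici.1 ht)]
  have hmod : ∀ z, olModular (Ici 0) φ ω z = olModular (Ici 0) φ ω' z := fun z =>
    setLIntegral_congr_fun measurableSet_Ici fun t ht => by rw [hcongr t ht]
  have hnorm : ∀ z, orliczNorm (Ici 0) φ ω z = orliczNorm (Ici 0) φ ω' z := fun z => by
    simp only [orliczNorm, hmod]
  have hanti : Antitone ω' := fun s t hst =>
    hω.2.1 (le_max_right s 0) (le_max_right t 0) (max_le_max_right 0 hst)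
  rw [setLIntegral_congr_fun measurableSet_Ici fun t ht => by rw [hcongr t ht]] at hωint
  rw [hnorm] at hxn
  obtain ⟨δ, hδ, h⟩ := exists_delta_of_antitone hφ hanti
    (fun t => hωpos _ (le_max_right t 0)) hψ hωint hx.1 hxn
  refine ⟨δ, hδ, fun y hy hyn => ?_⟩
  rw [hnorm] at hyn
  rw [hnorm, hnorm]
  exact h y hy.1 hyn
end
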